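/- Let G and H be nonempty closed subsets of a metric space (E,σ) such that (G,H) is a proximal pair and both (G,H) and (H,G) have property UC. Then every almost cyclic contraction T on G ∪ H is continuous. -/

import Mathlib

open Metric Filter Set

/-- Distance between two sets: `σ(G,H) = inf {σ(u,v) : u ∈ G, v ∈ H}`. -/
noncomputable def setDist {E : Type*} [MetricSpace E] (G H : Set E) : ℝ :=
  sInf (Set.image2 dist G H)

/-- The pair `(G,H)` has property UC. -/
def PropUC {E : Type*} [MetricSpace E] (G H : Set E) : Prop :=
  ∀ u z v : ℕ → E, (∀ n, u n ∈ G) → (∀ n, z n ∈ G) → (∀ n, v n ∈ H) →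
    Tendsto (fun n => dist (u n) (v n)) atTop (nhds (setDist G H)) →
    Tendsto (fun n => dist (z n) (v n)) atTop (nhds (setDist G H)) →
    Tendsto (fun n => dist (u n) (z n)) atTop (nhds 0)

/-- The pair `(G,H)` has property strongly UC. -/
def PropSUC {E : Type*} [MetricSpace E] (G H : Set E) : Prop :=
  ∀ u z v : ℕ → E, (∀ n, u n ∈ G) → (∀ n, z n ∈ G) → (∀ n, v n ∈ H) →
    Tendsto (fun n => dist (u n) (v n) - Metric.infDist (v n) G) atTop (nhds 0) →
    Tendsto (fun n => dist (z n) (v n) - Metric.infDist (v n) G) atTop (nhds 0) →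
    Tendsto (fun n => dist (u n) (z n)) atTop (nhds 0)

/-- `T` is an almost cyclic contraction on `G ∪ H`: it is cyclic and there is
`β ∈ [0,1)` with `σ(Tu,Tv) ≤ β·σ(u,v) + (1−β)·σ(v,G)` for all `u ∈ G`, `v ∈ H`. -/
def AlmostCyclicContraction {E : Type*} [MetricSpace E] (G H : Set E) (T : E → E) : Prop :=
  Set.MapsTo T G H ∧ Set.MapsTo T H G ∧
    ∃ β : ℝ, 0 ≤ β ∧ β < 1 ∧ ∀ u ∈ G, ∀ v ∈ H,
      dist (T u) (T v) ≤ β * dist u v + (1 - β) * Metric.infDist v G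

theorem setDist_le {E : Type*} [MetricSpace E] {G H : Set E} {u v : E} (hu : u ∈ G) (hv : v ∈ H) :
    setDist G H ≤ dist u v := by
  refine csInf_le ⟨0, ?_⟩ (Set.mem_image2_of_mem hu hv)
  rintro _ ⟨a, _, b, _, rfl⟩
  exact dist_nonneg

theorem setDist_comm' {E : Type*} [MetricSpace E] (G H : Set E) : setDist G H = setDist H G := by
  unfold setDist
  rw [Set.image2_swap]
  simp only [dist_comm]

theorem continuousOn_side {E : Type*} [MetricSpace E] (A B : Set E) (T : E → E)
    (hUC : PropUC B A) (hAB : Set.MapsTo T A B) (hBA : Set.MapsTo T B A)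
    (hp : ∀ u ∈ A, ∃ v ∈ B, dist u v = setDist A B) (β : ℝ)
    (hT : ∀ u ∈ A, ∀ v ∈ B, dist (T u) (T v) ≤ β * dist u v + (1 - β) * setDist A B) :
    ContinuousOn T A := by
  rw [continuousOn_iff_continuous_restrict, continuous_iff_seqContinuous]
  intro x a hx
  obtain ⟨y, hy, hay⟩ := hp a a.2
  have hx' : Tendsto (fun n => (x n : E)) atTop (nhds (a : E)) :=
    (continuous_subtype_val.tendsto a).comp hx
  have hd : Tendsto (fun n => dist (x n : E) y) atTop (nhds (setDist A B)) := by
    rw [← hay]; exact hx'.dist tendsto_const_nhds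
  have hub : Tendsto (fun n => β * dist (x n : E) y + (1 - β) * setDist A B) atTop
      (nhds (setDist A B)) := by
    have := (hd.const_mul β).add_const ((1 - β) * setDist A B)
    convert this using 2
    ring
  have hlow : ∀ u ∈ A, setDist A B ≤ dist (T u) (T y) := fun u hu => by
    rw [setDist_comm']; exact setDist_le (hAB hu) (hBA hy)
  have h1 : Tendsto (fun n => dist (T (x n)) (T y)) atTop (nhds (setDist B A)) := by
    rw [setDist_comm' B A]
    exact tendsto_of_tendsto_of_tendsto_of_le_of_le tendsto_const_nhds hub
      (fun n => hlow _ (x n).2) (fun n => hT _ (x n).2 _ hy)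
  have h2 : dist (T a) (T y) = setDist B A := by
    rw [setDist_comm' B A]
    refine le_antisymm ((hT _ a.2 _ hy).trans (le_of_eq ?_)) (hlow _ a.2)
    rw [hay]; ring
  have := hUC (fun n => T (x n)) (fun _ => T a) (fun _ => T y) (fun n => hAB (x n).2)
    (fun _ => hAB a.2) (fun _ => hBA hy) h1 (by rw [h2]; exact tendsto_const_nhds)
  exact tendsto_iff_dist_tendsto_zero.2 this

/-- Let `G` and `H` be nonempty closed subsets of a metric space such that `(G,H)` is
proximal and both `(G,H)` and `(H,G)` have property UC. Then every almost cyclic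
contraction `T` on `G ∪ H` is continuous on `G ∪ H`. -/
theorem continuous_almostCyclicContraction {E : Type*} [MetricSpace E]
    (G H : Set E) (hG : G.Nonempty) (hH : H.Nonempty)
    (hGc : IsClosed G) (hHc : IsClosed H)
    (hprox : (∀ u ∈ G, ∃ v ∈ H, dist u v = setDist G H) ∧
             (∀ v ∈ H, ∃ u ∈ G, dist u v = setDist G H))
    (hUC : PropUC G H) (hUC' : PropUC H G)
    (T : E → E) (hT : AlmostCyclicContraction G H T) :
    ContinuousOn T (G ∪ H) := by
  obtain ⟨hGH, hHG, β, hβ0, hβ1, hc⟩ := hT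
  have hinf : ∀ v ∈ H, Metric.infDist v G ≤ setDist G H := by
    intro v hv
    obtain ⟨u, hu, h⟩ := hprox.2 v hv
    rw [← h, dist_comm]
    exact Metric.infDist_le_dist_of_mem hu
  have hc' : ∀ u ∈ G, ∀ v ∈ H,
      dist (T u) (T v) ≤ β * dist u v + (1 - β) * setDist G H := fun u hu v hv =>
    (hc u hu v hv).trans (by
      have := mul_le_mul_of_nonneg_left (hinf v hv) (sub_nonneg.2 hβ1.le)
      linarith)
  have h1 := continuousOn_side G H T hUC' hGH hHG hprox.1 β hc'
  have h2 : ContinuousOn T H := by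
    refine continuousOn_side H G T hUC hHG hGH ?_ β ?_
    · intro v hv
      obtain ⟨u, hu, h⟩ := hprox.2 v hv
      exact ⟨u, hu, by rw [dist_comm, h, setDist_comm']⟩
    · intro v hv u hu
      rw [dist_comm (T v), dist_comm v, setDist_comm' H G]
      exact hc' u hu v hv
  exact h1.union_of_isClosed h2 hGc hHc
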